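/- Let Ψ : ℝ → ℝ satisfy x = -Ψ(x) - Ψ(x)³ for all x. Then Ψ is differentiable, Ψ(0) = 0, Ψ'(0) = -1, and Ψ satisfies the self-similar Burgers equation -½Ψ(x) + (³⁄₂x + Ψ(x))·Ψ'(x) = 0 for all x ∈ ℝ. -/

import Mathlib

theorem stmt2 (Ψ : ℝ → ℝ) (hΨ : ∀ x : ℝ, x = -Ψ x - Ψ x ^ 3) :
    Differentiable ℝ Ψ ∧ Ψ 0 = 0 ∧ deriv Ψ 0 = -1 ∧
      ∀ x : ℝ, -(1/2) * Ψ x + ((3/2) * x + Ψ x) * deriv Ψ x = 0 := by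
  have hlip : LipschitzWith 1 Ψ := by
    refine LipschitzWith.of_dist_le_mul fun x y => ?_
    rw [Real.dist_eq, Real.dist_eq, NNReal.coe_one, one_mul]
    have h : x - y = -((Ψ x - Ψ y) * (1 + (Ψ x ^ 2 + Ψ x * Ψ y + Ψ y ^ 2))) := by
      linear_combination hΨ x - hΨ y
    have h2 : 0 ≤ Ψ x ^ 2 + Ψ x * Ψ y + Ψ y ^ 2 := by
      nlinarith [sq_nonneg (Ψ x + Ψ y), sq_nonneg (Ψ x), sq_nonneg (Ψ y)]
    rw [h, abs_neg, abs_mul, abs_of_nonneg (a := 1 + _) (by linarith)]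
    nlinarith [abs_nonneg (Ψ x - Ψ y), mul_nonneg (abs_nonneg (Ψ x - Ψ y)) h2]
  have hne : ∀ y : ℝ, -1 - 3 * y ^ 2 ≠ 0 := fun y => by nlinarith [sq_nonneg y]
  have hd : ∀ x, HasDerivAt Ψ (-1 - 3 * Ψ x ^ 2)⁻¹ x := by
    intro x
    refine HasDerivAt.of_local_left_inverse (f := fun y => -y - y ^ 3)
      hlip.continuous.continuousAt ?_ (hne _) (Filter.Eventually.of_forall fun y => (hΨ y).symm)
    have := (hasDerivAt_id (Ψ x)).neg.sub (hasDerivAt_pow 3 (Ψ x))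
    have e : -1 - ((3 : ℕ) : ℝ) * Ψ x ^ (3 - 1) = -1 - 3 * Ψ x ^ 2 := by norm_num
    rw [e] at this
    exact this
  have h0 : Ψ 0 = 0 := by
    have h : Ψ 0 * (1 + Ψ 0 ^ 2) = 0 := by linear_combination hΨ 0
    rcases mul_eq_zero.1 h with h | h
    · exact h
    · nlinarith [sq_nonneg (Ψ 0)]
  refine ⟨fun x => (hd x).differentiableAt, h0, ?_, fun x => ?_⟩
  · rw [(hd 0).deriv, h0]; norm_num
  · rw [(hd x).deriv]
    have h1 := mul_inv_cancel₀ (hne (Ψ x))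
    linear_combination (3/2) * (-1 - 3 * Ψ x ^ 2)⁻¹ * hΨ x + (1/2) * Ψ x * h1
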